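/- Let n ≥ 2, q > 0 and p ∈ ℝ with 1 < p + q < (n+3)/(n−1). Set a = (p+q−1)/q > 0. Then there exists a constant C = C(n,p,q) > 0 such that for every x₀ ∈ ℝ^n, every R > 0 and every positive classical solution u of Δu + |∇u|^q u^p = 0 on the ball B(x₀, 2R) ⊂ ℝ^n, one has sup_{B(x₀,R)} |∇(u^a)| ≤ C · R^{−2/q}. Moreover, if in addition p > 1, then sup_{B(x₀,R)} |∇u| ≤ C · R^{−1 − (2−q)/(p+q−1)}. -/

import Mathlib

open scoped BigOperators

/-- The Euclidean Laplacian of `u : ℝⁿ → ℝ`, defined as the sum of the second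
partial derivatives in the coordinate directions. -/
noncomputable def elaplacian {n : ℕ} (u : EuclideanSpace ℝ (Fin n) → ℝ)
    (x : EuclideanSpace ℝ (Fin n)) : ℝ :=
  ∑ i : Fin n, fderiv ℝ (fun y => fderiv ℝ u y (EuclideanSpace.single i 1)) x
    (EuclideanSpace.single i 1)

open Filter Topology Metric

section PartialDerivatives

/-- The `i`-th partial derivative. -/
noncomputable def pderiv {n : ℕ} (i : Fin n) (v : EuclideanSpace ℝ (Fin n) → ℝ)
    (x : EuclideanSpace ℝ (Fin n)) : ℝ :=
  fderiv ℝ v x (EuclideanSpace.single i 1)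

/-- The squared norm of the gradient, written in coordinates. -/
noncomputable def gradSq {n : ℕ} (v : EuclideanSpace ℝ (Fin n) → ℝ)
    (x : EuclideanSpace ℝ (Fin n)) : ℝ :=
  ∑ i, pderiv i v x ^ 2

variable {n : ℕ} {v w : EuclideanSpace ℝ (Fin n) → ℝ} {x : EuclideanSpace ℝ (Fin n)}

lemma elaplacian_eq_sum_pderiv (v : EuclideanSpace ℝ (Fin n) → ℝ)
    (x : EuclideanSpace ℝ (Fin n)) : elaplacian v x = ∑ i, pderiv i (pderiv i v) x := rfl

lemma gradSq_nonneg (v : EuclideanSpace ℝ (Fin n) → ℝ) (x : EuclideanSpace ℝ (Fin n)) :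
    0 ≤ gradSq v x := Finset.sum_nonneg fun _ _ => sq_nonneg _

lemma gradient_apply (v : EuclideanSpace ℝ (Fin n) → ℝ) (x : EuclideanSpace ℝ (Fin n))
    (i : Fin n) : gradient v x i = pderiv i v x := by
  have h := inner_gradient_left (f := v) (x := x) (y := EuclideanSpace.single i (1 : ℝ))
  rw [pderiv, ← h, EuclideanSpace.inner_single_right]
  simp

lemma norm_gradient_sq (v : EuclideanSpace ℝ (Fin n) → ℝ) (x : EuclideanSpace ℝ (Fin n)) :
    ‖gradient v x‖ ^ 2 = gradSq v x := by
  simp [EuclideanSpace.norm_sq_eq, gradSq, gradient_apply]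

lemma Filter.EventuallyEq.pderiv_eq (h : v =ᶠ[𝓝 x] w) (i : Fin n) :
    pderiv i v x = pderiv i w x := by
  rw [pderiv, pderiv, h.fderiv_eq]

lemma pderiv_add (hv : DifferentiableAt ℝ v x) (hw : DifferentiableAt ℝ w x) (i : Fin n) :
    pderiv i (fun y => v y + w y) x = pderiv i v x + pderiv i w x := by
  simp [pderiv, fderiv_fun_add hv hw]

lemma pderiv_sub (hv : DifferentiableAt ℝ v x) (hw : DifferentiableAt ℝ w x) (i : Fin n) :
    pderiv i (fun y => v y - w y) x = pderiv i v x - pderiv i w x := by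
  simp [pderiv, fderiv_fun_sub hv hw]

lemma pderiv_const_mul (hv : DifferentiableAt ℝ v x) (c : ℝ) (i : Fin n) :
    pderiv i (fun y => c * v y) x = c * pderiv i v x := by
  simp [pderiv, fderiv_const_mul hv]

lemma pderiv_mul (hv : DifferentiableAt ℝ v x) (hw : DifferentiableAt ℝ w x) (i : Fin n) :
    pderiv i (fun y => v y * w y) x = pderiv i v x * w x + v x * pderiv i w x := by
  simp [pderiv, fderiv_fun_mul hv hw]
  ring

lemma pderiv_sum {ι : Type*} {s : Finset ι} {g : ι → EuclideanSpace ℝ (Fin n) → ℝ}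
    (hg : ∀ j ∈ s, DifferentiableAt ℝ (g j) x) (i : Fin n) :
    pderiv i (fun y => ∑ j ∈ s, g j y) x = ∑ j ∈ s, pderiv i (g j) x := by
  simp [pderiv, fderiv_fun_sum hg]

lemma pderiv_comp {g : ℝ → ℝ} {g' : ℝ} (hg : HasDerivAt g g' (v x))
    (hv : DifferentiableAt ℝ v x) (i : Fin n) :
    pderiv i (fun y => g (v y)) x = g' * pderiv i v x := by
  have := (hg.comp_hasFDerivAt x hv.hasFDerivAt).fderiv
  rw [pderiv, pderiv]
  change fderiv ℝ (g ∘ v) x _ = _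
  rw [this]
  simp

lemma pderiv_comp_add (a : EuclideanSpace ℝ (Fin n)) (i : Fin n) :
    pderiv i (fun y => v (y + a)) x = pderiv i v (x + a) := by
  rw [pderiv, pderiv, fderiv_comp_add_right]

lemma ContDiffAt.pderiv {m k : WithTop ℕ∞} (hv : ContDiffAt ℝ m v x) (hk : k + 1 ≤ m)
    (i : Fin n) : ContDiffAt ℝ k (pderiv i v) x :=
  (hv.fderiv_right hk).clm_apply contDiffAt_const

lemma ContDiffAt.pderiv_one (hv : ContDiffAt ℝ 2 v x) (i : Fin n) :
    ContDiffAt ℝ 1 (_root_.pderiv i v) x :=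
  hv.pderiv (by norm_num [one_add_one_eq_two]) i

lemma pderiv_comm (hv : ContDiffAt ℝ 2 v x) (i j : Fin n) :
    pderiv i (pderiv j v) x = pderiv j (pderiv i v) x := by
  have hd : DifferentiableAt ℝ (fderiv ℝ v) x :=
    (hv.fderiv_right (m := 1) (by norm_num [one_add_one_eq_two])).differentiableAt one_ne_zero
  have key : ∀ i j : Fin n, pderiv i (pderiv j v) x =
      fderiv ℝ (fderiv ℝ v) x (EuclideanSpace.single i 1) (EuclideanSpace.single j 1) := by
    intro i j
    have h := (hd.hasFDerivAt.clm_apply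
      (hasFDerivAt_const (EuclideanSpace.single j (1 : ℝ)) x)).fderiv
    change fderiv ℝ (fun y => fderiv ℝ v y (EuclideanSpace.single j 1)) x _ = _
    rw [h]
    simp
  rw [key, key]
  exact (hv.isSymmSndFDerivAt (by simp)).eq _ _

lemma eventually_differentiableAt (hv : ContDiffAt ℝ 2 v x) :
    ∀ᶠ y in 𝓝 x, DifferentiableAt ℝ v y :=
  (hv.eventually (by simp)).mono fun _ h => h.differentiableAt two_ne_zero

lemma pderiv_pderiv_add (hv : ContDiffAt ℝ 2 v x) (hw : ContDiffAt ℝ 2 w x) (i : Fin n) :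
    pderiv i (pderiv i fun y => v y + w y) x
      = pderiv i (pderiv i v) x + pderiv i (pderiv i w) x := by
  have h : (pderiv i fun y => v y + w y) =ᶠ[𝓝 x] fun y => pderiv i v y + pderiv i w y := by
    filter_upwards [eventually_differentiableAt hv, eventually_differentiableAt hw]
      with y h1 h2 using pderiv_add h1 h2 i
  rw [h.pderiv_eq, pderiv_add ((hv.pderiv_one i).differentiableAt one_ne_zero)
    ((hw.pderiv_one i).differentiableAt one_ne_zero)]

lemma pderiv_pderiv_mul (hv : ContDiffAt ℝ 2 v x) (hw : ContDiffAt ℝ 2 w x) (i : Fin n) :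
    pderiv i (pderiv i fun y => v y * w y) x
      = pderiv i (pderiv i v) x * w x + 2 * (pderiv i v x * pderiv i w x)
        + v x * pderiv i (pderiv i w) x := by
  have h : (pderiv i fun y => v y * w y) =ᶠ[𝓝 x]
      fun y => pderiv i v y * w y + v y * pderiv i w y := by
    filter_upwards [eventually_differentiableAt hv, eventually_differentiableAt hw]
      with y h1 h2 using pderiv_mul h1 h2 i
  have v0 := hv.differentiableAt two_ne_zero
  have w0 := hw.differentiableAt two_ne_zero
  have v1 := (hv.pderiv_one i).differentiableAt one_ne_zero
  have w1 := (hw.pderiv_one i).differentiableAt one_ne_zero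
  rw [h.pderiv_eq, pderiv_add (v1.fun_mul w0) (v0.fun_mul w1), pderiv_mul v1 w0, pderiv_mul v0 w1]
  ring

lemma pderiv_pderiv_sum {ι : Type*} {s : Finset ι} {g : ι → EuclideanSpace ℝ (Fin n) → ℝ}
    (hg : ∀ j ∈ s, ContDiffAt ℝ 2 (g j) x) (i : Fin n) :
    pderiv i (pderiv i fun y => ∑ j ∈ s, g j y) x = ∑ j ∈ s, pderiv i (pderiv i (g j)) x := by
  have h : (pderiv i fun y => ∑ j ∈ s, g j y) =ᶠ[𝓝 x] fun y => ∑ j ∈ s, pderiv i (g j) y := by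
    filter_upwards [(Filter.eventually_all_finset s).2
      fun j hj => eventually_differentiableAt (hg j hj)] with y hy using pderiv_sum hy i
  rw [h.pderiv_eq, pderiv_sum fun j hj => ((hg j hj).pderiv_one i).differentiableAt one_ne_zero]

lemma pderiv_pderiv_comp {g g' : ℝ → ℝ} {g'' : ℝ} (hg : ∀ᶠ t in 𝓝 (v x), HasDerivAt g (g' t) t)
    (hg' : HasDerivAt g' g'' (v x)) (hv : ContDiffAt ℝ 2 v x) (i : Fin n) :
    pderiv i (pderiv i fun y => g (v y)) x
      = g' (v x) * pderiv i (pderiv i v) x + g'' * pderiv i v x ^ 2 := by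
  have v0 := hv.differentiableAt two_ne_zero
  have v1 := (hv.pderiv_one i).differentiableAt one_ne_zero
  have h : (pderiv i fun y => g (v y)) =ᶠ[𝓝 x] fun y => g' (v y) * pderiv i v y := by
    filter_upwards [eventually_differentiableAt hv, v0.continuousAt.eventually hg]
      with y h1 h2 using pderiv_comp h2 h1 i
  rw [h.pderiv_eq, pderiv_mul (hg'.differentiableAt.fun_comp' x v0) v1, pderiv_comp hg' v0]
  ring

lemma elaplacian_add (hv : ContDiffAt ℝ 2 v x) (hw : ContDiffAt ℝ 2 w x) :
    elaplacian (fun y => v y + w y) x = elaplacian v x + elaplacian w x := by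
  simp only [elaplacian_eq_sum_pderiv, pderiv_pderiv_add hv hw, Finset.sum_add_distrib]

lemma elaplacian_const_mul (hv : ContDiffAt ℝ 2 v x) (c : ℝ) :
    elaplacian (fun y => c * v y) x = c * elaplacian v x := by
  simp only [elaplacian_eq_sum_pderiv, Finset.mul_sum]
  refine Finset.sum_congr rfl fun i _ => ?_
  have := pderiv_pderiv_comp (g := fun t => c * t) (g' := fun _ => c) (g'' := 0)
    (.of_forall fun t => by simpa using (hasDerivAt_id t).const_mul c) (hasDerivAt_const _ _) hv i
  simpa using this

lemma pderiv_log (hv : DifferentiableAt ℝ v x) (hx : v x ≠ 0) (i : Fin n) :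
    pderiv i (fun y => Real.log (v y)) x = pderiv i v x / v x := by
  rw [pderiv_comp (Real.hasDerivAt_log hx) hv]
  ring

lemma gradSq_log (hv : DifferentiableAt ℝ v x) (hx : v x ≠ 0) :
    gradSq (fun y => Real.log (v y)) x = gradSq v x / v x ^ 2 := by
  rw [gradSq, gradSq, Finset.sum_div]
  exact Finset.sum_congr rfl fun i _ => by rw [pderiv_log hv hx, div_pow]

lemma elaplacian_log (hv : ContDiffAt ℝ 2 v x) (hx : v x ≠ 0) :
    elaplacian (fun y => Real.log (v y)) x = elaplacian v x / v x - gradSq v x / v x ^ 2 := by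
  simp only [elaplacian_eq_sum_pderiv, gradSq, Finset.sum_div, ← Finset.sum_sub_distrib]
  refine Finset.sum_congr rfl fun i _ => ?_
  rw [pderiv_pderiv_comp (g' := fun t => t⁻¹) ((isOpen_ne.eventually_mem hx).mono
    fun t ht => Real.hasDerivAt_log ht) (hasDerivAt_inv hx) hv]
  ring

lemma hasFDerivAt_coord_sub (c : EuclideanSpace ℝ (Fin n)) (i : Fin n) :
    HasFDerivAt (fun y : EuclideanSpace ℝ (Fin n) => y i - c i)
      (EuclideanSpace.proj i : EuclideanSpace ℝ (Fin n) →L[ℝ] ℝ) x :=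
  (EuclideanSpace.proj i : EuclideanSpace ℝ (Fin n) →L[ℝ] ℝ).hasFDerivAt.sub_const (c i)

lemma contDiff_norm_sub_sq (c : EuclideanSpace ℝ (Fin n)) :
    ContDiff ℝ 2 fun y : EuclideanSpace ℝ (Fin n) => ‖y - c‖ ^ 2 :=
  (contDiff_id.sub contDiff_const).norm_sq ℝ

lemma pderiv_norm_sub_sq (c : EuclideanSpace ℝ (Fin n)) (i : Fin n)
    (x : EuclideanSpace ℝ (Fin n)) :
    pderiv i (fun y => ‖y - c‖ ^ 2) x = 2 * (x i - c i) := by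
  have h := ((hasFDerivAt_id (𝕜 := ℝ) x).sub_const c).norm_sq.fderiv
  rw [pderiv]
  change fderiv ℝ (fun y => ‖id y - c‖ ^ 2) x _ = _
  rw [h]
  simp [EuclideanSpace.inner_single_right]

lemma gradSq_norm_sub_sq (c x : EuclideanSpace ℝ (Fin n)) :
    gradSq (fun y => ‖y - c‖ ^ 2) x = 4 * ‖x - c‖ ^ 2 := by
  simp only [gradSq, pderiv_norm_sub_sq]
  rw [EuclideanSpace.norm_sq_eq, Finset.mul_sum]
  refine Finset.sum_congr rfl fun i _ => ?_
  simp
  ring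

lemma elaplacian_norm_sub_sq (c x : EuclideanSpace ℝ (Fin n)) :
    elaplacian (fun y => ‖y - c‖ ^ 2) x = 2 * n := by
  have h : ∀ i : Fin n, pderiv i (pderiv i fun y => ‖y - c‖ ^ 2) x = 2 := by
    intro i
    rw [show (pderiv i fun y : EuclideanSpace ℝ (Fin n) => ‖y - c‖ ^ 2)
      = fun y => 2 * (y i - c i) from funext (pderiv_norm_sub_sq c i),
      pderiv_const_mul (hasFDerivAt_coord_sub c i).differentiableAt, pderiv,
      (hasFDerivAt_coord_sub c i).fderiv]
    simp
  simp [elaplacian_eq_sum_pderiv, h, mul_comm]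

end PartialDerivatives

section MaximumPrinciple

variable {n : ℕ} {v w : EuclideanSpace ℝ (Fin n) → ℝ} {x : EuclideanSpace ℝ (Fin n)}

lemma IsLocalMax.pderiv_eq_zero (h : IsLocalMax v x) (i : Fin n) : pderiv i v x = 0 := by
  rw [pderiv, h.fderiv_eq_zero]
  rfl

lemma hasDerivAt_line {t : ℝ} {i : Fin n}
    (hv : DifferentiableAt ℝ v (x + t • EuclideanSpace.single i (1 : ℝ))) :
    HasDerivAt (fun s : ℝ => v (x + s • EuclideanSpace.single i (1 : ℝ)))
      (pderiv i v (x + t • EuclideanSpace.single i (1 : ℝ))) t := by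
  have h : HasDerivAt (fun s : ℝ => x + s • EuclideanSpace.single i (1 : ℝ))
      (EuclideanSpace.single i (1 : ℝ)) t := by
    simpa using ((hasDerivAt_id t).smul_const (EuclideanSpace.single i (1 : ℝ))).const_add x
  exact hv.hasFDerivAt.comp_hasDerivAt t h

lemma tendsto_line (x : EuclideanSpace ℝ (Fin n)) (i : Fin n) :
    Tendsto (fun s : ℝ => x + s • EuclideanSpace.single i (1 : ℝ)) (𝓝 0) (𝓝 x) := by
  have : Continuous fun s : ℝ => x + s • EuclideanSpace.single i (1 : ℝ) := by fun_prop
  simpa using this.tendsto 0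

lemma IsLocalMax.pderiv_pderiv_nonpos (hv : ContDiffAt ℝ 2 v x) (h : IsLocalMax v x)
    (i : Fin n) : pderiv i (pderiv i v) x ≤ 0 := by
  by_contra! hpos
  set g : ℝ → ℝ := fun s => v (x + s • EuclideanSpace.single i (1 : ℝ)) with hg
  have hmax : IsLocalMax g 0 := by
    have := (tendsto_line x i).eventually h
    simpa [IsLocalMax, IsMaxFilter, hg] using this
  have hd : deriv g =ᶠ[𝓝 0]
      fun s => pderiv i v (x + s • EuclideanSpace.single i (1 : ℝ)) := by
    filter_upwards [(tendsto_line x i).eventually (eventually_differentiableAt hv)] with s hs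
    exact (hasDerivAt_line hs).deriv
  have hdd : deriv (deriv g) 0 = pderiv i (pderiv i v) x := by
    rw [hd.deriv_eq]
    have h1 : DifferentiableAt ℝ (pderiv i v) (x + (0 : ℝ) • EuclideanSpace.single i (1 : ℝ)) := by
      simpa using (hv.pderiv_one i).differentiableAt one_ne_zero
    simpa using (hasDerivAt_line h1).deriv
  have hc : ContinuousAt g 0 := by
    have h0 : DifferentiableAt ℝ v (x + (0 : ℝ) • EuclideanSpace.single i (1 : ℝ)) := by
      simpa using hv.differentiableAt two_ne_zero
    exact (hasDerivAt_line h0).continuousAt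
  have hmin : IsLocalMin g 0 :=
    isLocalMin_of_deriv_deriv_pos (by rwa [hdd]) hmax.deriv_eq_zero hc
  have hconst : g =ᶠ[𝓝 0] fun _ => g 0 := by
    filter_upwards [hmax, hmin] with s h1 h2 using le_antisymm h1 h2
  have hd0 : deriv g =ᶠ[𝓝 0] fun _ => 0 := by simpa using hconst.deriv
  rw [← hdd, hd0.deriv_eq] at hpos
  simp at hpos

lemma IsLocalMax.elaplacian_nonpos (hv : ContDiffAt ℝ 2 v x) (h : IsLocalMax v x) :
    elaplacian v x ≤ 0 :=
  Finset.sum_nonpos fun i _ => h.pderiv_pderiv_nonpos hv i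

/-- If `C²` functions converge (continuously) to a function with a local maximum at `x`, and
their Laplacians converge near `x`, then the limit of the Laplacians at `x` is nonpositive. -/
lemma limit_elaplacian_nonpos {P : EuclideanSpace ℝ (Fin n) → ℝ}
    {Q : ℕ → EuclideanSpace ℝ (Fin n) → ℝ} {H δ : ℝ} (hδ : 0 < δ)
    (hmax : ∀ y ∈ closedBall x δ, P y ≤ P x)
    (hlim : ∀ y ∈ closedBall x δ,
      Tendsto (fun k : ℕ × EuclideanSpace ℝ (Fin n) => Q k.1 k.2) (atTop ×ˢ 𝓝 y) (𝓝 (P y)))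
    (hsmooth : ∀ᶠ k : ℕ × EuclideanSpace ℝ (Fin n) in atTop ×ˢ 𝓝 x, ContDiffAt ℝ 2 (Q k.1) k.2)
    (hlap : Tendsto (fun k : ℕ × EuclideanSpace ℝ (Fin n) => elaplacian (Q k.1) k.2)
      (atTop ×ˢ 𝓝 x) (𝓝 H)) : H ≤ 0 := by
  by_contra! hH
  obtain ⟨s, hs, t, ht, hst⟩ := Filter.eventually_prod_iff.1
    (hsmooth.and (hlap.eventually (lt_mem_nhds (half_lt_self hH))))
  obtain ⟨K, hK⟩ := eventually_atTop.1 hs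
  obtain ⟨ε, hε, hεt⟩ := Metric.eventually_nhds_iff_ball.1 ht
  set ρ := min (ε / 2) δ with hρ
  have hρ0 : 0 < ρ := lt_min (half_pos hε) hδ
  have hρε : closedBall x ρ ⊆ ball x ε := closedBall_subset_ball
    ((min_le_left _ _).trans_lt (half_lt_self hε))
  set κ := H / (4 * n + 4) with hκ
  have hn4 : (0 : ℝ) < 4 * n + 4 := by positivity
  have hκ0 : 0 < κ := div_pos hH hn4
  have hκn : 2 * n * κ < H / 2 := by
    rw [hκ]
    field_simp
    linarith
  have hmaxk : ∀ k, ∃ y ∈ closedBall x ρ,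
      ‖y - x‖ = ρ ∧ Q (k + K) x ≤ Q (k + K) y + -κ * ρ ^ 2 := by
    intro k
    have hsm : ∀ y ∈ closedBall x ρ, ContDiffAt ℝ 2 (fun y => Q (k + K) y + -κ * ‖y - x‖ ^ 2) y :=
      fun y hy => (hst (hK _ (Nat.le_add_left _ _)) (hεt y (hρε hy))).1.add
        (contDiffAt_const.mul (contDiff_norm_sub_sq x).contDiffAt)
    obtain ⟨y, hy, hymax⟩ := (isCompact_closedBall x ρ).exists_isMaxOn
      ⟨x, mem_closedBall_self hρ0.le⟩
      (fun y hy => (hsm y hy).continuousAt.continuousWithinAt)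
    have hyρ : ‖y - x‖ = ρ := by
      refine le_antisymm (mem_closedBall_iff_norm.1 hy) (not_lt.1 fun hlt => ?_)
      have hloc := hymax.isLocalMax (mem_of_superset
        (isOpen_ball.mem_nhds (mem_ball_iff_norm.2 hlt)) ball_subset_closedBall)
      have h1 := hloc.elaplacian_nonpos (hsm y hy)
      obtain ⟨h2, h3⟩ := hst (hK _ (Nat.le_add_left K k)) (hεt y (hρε hy))
      rw [elaplacian_add h2 (contDiffAt_const.mul (contDiff_norm_sub_sq x).contDiffAt),
        elaplacian_const_mul (contDiff_norm_sub_sq x).contDiffAt, elaplacian_norm_sub_sq] at h1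
      linarith
    refine ⟨y, hy, hyρ, ?_⟩
    have := hymax (mem_closedBall_self hρ0.le)
    simpa [hyρ] using this
  choose y hy hyρ hyQ using hmaxk
  obtain ⟨z, hz, θ, hθ, hlimz⟩ := (isCompact_closedBall x ρ).tendsto_subseq hy
  have hθK : Tendsto (fun k => θ k + K) atTop atTop :=
    tendsto_atTop_mono (fun k => Nat.le_add_right _ _) hθ.tendsto_atTop
  have h1 := (hlim z (closedBall_subset_closedBall (min_le_right _ _) hz)).comp
    (hθK.prodMk hlimz)
  have h2 := (hlim x (mem_closedBall_self hδ.le)).comp (hθK.prodMk (tendsto_const_nhds (x := x)))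
  have h3 := le_of_tendsto_of_tendsto' h2 (h1.add_const (-κ * ρ ^ 2)) fun k => hyQ (θ k)
  have h4 := hmax z (closedBall_subset_closedBall (min_le_right _ _) hz)
  nlinarith [mul_pos hκ0 (pow_pos hρ0 2)]

end MaximumPrinciple

section DifferenceQuotients

variable {n : ℕ} {v w φ : EuclideanSpace ℝ (Fin n) → ℝ} {x : EuclideanSpace ℝ (Fin n)}

/-- The shift `1 / (k + 1)` times the `j`-th basis vector. -/
noncomputable def shift (k : ℕ) (j : Fin n) : EuclideanSpace ℝ (Fin n) :=
  ((k : ℝ) + 1)⁻¹ • EuclideanSpace.single j (1 : ℝ)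

/-- The difference quotient in direction `j` with step `1 / (k + 1)`. -/
noncomputable def diffQuot (k : ℕ) (j : Fin n) (v : EuclideanSpace ℝ (Fin n) → ℝ)
    (x : EuclideanSpace ℝ (Fin n)) : ℝ :=
  ((k : ℝ) + 1) * (v (x + shift k j) - v x)

lemma tendsto_add_shift (x : EuclideanSpace ℝ (Fin n)) (j : Fin n) :
    Tendsto (fun k : ℕ × EuclideanSpace ℝ (Fin n) => k.2 + shift k.1 j)
      (atTop ×ˢ 𝓝 x) (𝓝 x) := by
  have h1 : Tendsto (fun k : ℕ => shift k j) atTop (𝓝 0) := by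
    have h0 : Tendsto (fun k : ℕ => ((k : ℝ) + 1)⁻¹) atTop (𝓝 0) := by
      simpa using tendsto_one_div_add_atTop_nhds_zero_nat (𝕜 := ℝ)
    simpa [shift] using h0.smul_const (EuclideanSpace.single j (1 : ℝ))
  simpa using tendsto_snd.add (h1.comp (tendsto_fst (f := atTop) (g := 𝓝 x)))

lemma tendsto_diffQuot (hv : ContDiffAt ℝ 1 v x) (j : Fin n) :
    Tendsto (fun k : ℕ × EuclideanSpace ℝ (Fin n) => diffQuot k.1 j v k.2)
      (atTop ×ˢ 𝓝 x) (𝓝 (pderiv j v x)) := by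
  have h1 := (hv.hasStrictFDerivAt one_ne_zero).isLittleO.comp_tendsto
    ((tendsto_add_shift x j).prodMk_nhds (tendsto_snd (f := (atTop : Filter ℕ)) (g := 𝓝 x)))
  rw [tendsto_iff_norm_sub_tendsto_zero]
  refine h1.norm_norm.tendsto_div_nhds_zero.congr fun k => ?_
  have hk : (0 : ℝ) < (k.1 : ℝ) + 1 := by positivity
  have hs : ‖shift k.1 j‖ = ((k.1 : ℝ) + 1)⁻¹ := by
    rw [shift, norm_smul, Real.norm_of_nonneg (inv_nonneg.2 hk.le)]
    simp
  have hd : fderiv ℝ v x (shift k.1 j) = ((k.1 : ℝ) + 1)⁻¹ * pderiv j v x := by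
    simp [shift, pderiv]
  simp only [Function.comp_apply, add_sub_cancel_left, hs, hd, div_inv_eq_mul, diffQuot]
  rw [mul_comm, ← Real.norm_of_nonneg hk.le, ← norm_mul, Real.norm_of_nonneg hk.le]
  congr 1
  field_simp

lemma pderiv_diffQuot {k : ℕ} {j : Fin n} (h1 : DifferentiableAt ℝ v (x + shift k j))
    (h2 : DifferentiableAt ℝ v x) (i : Fin n) :
    pderiv i (diffQuot k j v) x = diffQuot k j (pderiv i v) x := by
  have h3 : DifferentiableAt ℝ (fun y => v (y + shift k j)) x :=
    (differentiableAt_comp_add_right _).2 h1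
  change pderiv i (fun y => ((k : ℝ) + 1) * (v (y + shift k j) - v y)) x = _
  rw [pderiv_const_mul (h3.fun_sub h2), pderiv_sub h3 h2, pderiv_comp_add]
  rfl

lemma ContDiffAt.diffQuot {k : ℕ} {j : Fin n} {m : WithTop ℕ∞}
    (h1 : ContDiffAt ℝ m v (x + shift k j)) (h2 : ContDiffAt ℝ m v x) :
    ContDiffAt ℝ m (_root_.diffQuot k j v) x :=
  contDiffAt_const.mul ((h1.comp x (contDiffAt_id.add contDiffAt_const)).sub h2)

end DifferenceQuotients

section Bernstein

/-- A refinement of `|M|² ≥ (tr M)² / n` for symmetric matrices that singles out the action of `M`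
on a given vector `v`. -/
lemma sum_sq_symm_ge {n : ℕ} (hn : 2 ≤ n) {M : Fin n → Fin n → ℝ} (hM : ∀ i j, M i j = M j i)
    {v A : Fin n → ℝ} {Y t : ℝ} (hY : Y = ∑ i, v i ^ 2) (hY0 : 0 < Y)
    (hA : ∀ i, A i = ∑ j, M i j * v j) (ht : t * Y = ∑ i, v i * A i) :
    2 * (∑ i, A i ^ 2) / Y - t ^ 2 + (∑ i, M i i - t) ^ 2 / ((n : ℝ) - 1)
      ≤ ∑ i, ∑ j, M i j ^ 2 := by
  have hn1 : (0 : ℝ) < n - 1 := by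
    have : (2 : ℝ) ≤ n := by exact_mod_cast hn
    linarith
  set T := ∑ i, M i i with hT
  set a := ∑ i, A i ^ 2 with ha
  set s := Y⁻¹ with hs
  have hsY : s * Y = 1 := inv_mul_cancel₀ hY0.ne'
  set c := (T - t) / ((n : ℝ) - 1) with hc
  have hcT : c * (n - 1) = T - t := div_mul_cancel₀ _ hn1.ne'
  set β := t + c with hβ
  have hrow : ∀ i, ∑ j, (M i j - s * v i * A j - s * A i * v j + β * s * v i * v j
      - c * (if i = j then 1 else 0)) ^ 2
      = ∑ j, M i j ^ 2 + s ^ 2 * a * v i ^ 2 + s ^ 2 * Y * A i ^ 2 + β ^ 2 * s ^ 2 * Y * v i ^ 2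
        + c ^ 2 - 2 * s * (v i * ∑ j, M i j * A j) - 2 * s * A i ^ 2
        + 2 * β * s * (v i * A i) - 2 * c * M i i + 2 * s ^ 2 * t * Y * (v i * A i)
        - 2 * β * s ^ 2 * t * Y * v i ^ 2 + 4 * c * s * (v i * A i)
        - 2 * β * s ^ 2 * Y * (v i * A i) - 2 * c * β * s * v i ^ 2 := by
    intro i
    have hj : ∀ j, (M i j - s * v i * A j - s * A i * v j + β * s * v i * v j
        - c * (if i = j then 1 else 0)) ^ 2
        = M i j ^ 2 + (s ^ 2 * v i ^ 2) * A j ^ 2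
          + (s ^ 2 * A i ^ 2 + β ^ 2 * s ^ 2 * v i ^ 2 - 2 * β * s ^ 2 * (v i * A i)) * v j ^ 2
          + (- 2 * s * v i) * (M i j * A j)
          + (- 2 * s * A i + 2 * β * s * v i) * (M i j * v j)
          + (2 * s ^ 2 * (v i * A i) - 2 * β * s ^ 2 * v i ^ 2) * (v j * A j)
          + (if i = j then c ^ 2 - 2 * c * M i j + 2 * c * s * v i * A j + 2 * c * s * A i * v j
              - 2 * c * β * s * v i * v j else 0) := by
      intro j
      split_ifs <;> ring
    simp only [hj, Finset.sum_add_distrib, ← Finset.mul_sum, Finset.sum_ite_eq, Finset.mem_univ,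
      if_true]
    rw [← hA, ← hY, ← ht, ← ha]
    ring
  have hMA : ∑ i, v i * ∑ j, M i j * A j = a := by
    simp only [Finset.mul_sum]
    rw [Finset.sum_comm, ha]
    refine Finset.sum_congr rfl fun j _ => ?_
    rw [sq, hA j, Finset.sum_mul]
    refine Finset.sum_congr rfl fun i _ => ?_
    rw [hM i j, ← hA j]
    ring
  have htot : 0 ≤ ∑ i, ∑ j, (M i j - s * v i * A j - s * A i * v j + β * s * v i * v j
      - c * (if i = j then 1 else 0)) ^ 2 :=
    Finset.sum_nonneg fun i _ => Finset.sum_nonneg fun j _ => sq_nonneg _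
  simp only [hrow, Finset.sum_add_distrib, Finset.sum_sub_distrib, ← Finset.mul_sum, ← hY, ← ht,
    hMA, ← ha, ← hT, Finset.sum_const, Finset.card_univ, Fintype.card_fin, nsmul_eq_mul] at htot
  have e1 : 2 * a / Y = 2 * a * s := by rw [hs, div_eq_mul_inv]
  have e2 : (T - t) ^ 2 / ((n : ℝ) - 1) = c * (T - t) := by
    rw [hc]
    ring
  rw [e1, e2, ← hcT]
  have hT' : T = c * (n - 1) + t := by linarith
  rw [hT', hβ] at htot
  linear_combination htot + (2 * s * a + 2 * (t + c) * t + 4 * c * t - 2 * c * (t + c)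
    + (s * Y + 1) * ((t + c) ^ 2 + 2 * t ^ 2 - 4 * (t + c) * t)) * hsY

variable {n : ℕ} {w φ : EuclideanSpace ℝ (Fin n) → ℝ} {x : EuclideanSpace ℝ (Fin n)}

lemma ContDiffAt.gradSq (hw : ContDiffAt ℝ 2 w x) : ContDiffAt ℝ 1 (_root_.gradSq w) x :=
  ContDiffAt.sum fun i _ => (hw.pderiv_one i).pow 2

lemma pderiv_gradSq (hw : ContDiffAt ℝ 2 w x) (i : Fin n) :
    pderiv i (gradSq w) x = 2 * ∑ j, pderiv j w x * pderiv i (pderiv j w) x := by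
  have hd : ∀ j : Fin n, DifferentiableAt ℝ (pderiv j w) x :=
    fun j => (hw.pderiv_one j).differentiableAt one_ne_zero
  change pderiv i (fun y => ∑ j, pderiv j w y ^ 2) x = _
  rw [pderiv_sum fun j _ => (hd j).fun_pow 2, Finset.mul_sum]
  refine Finset.sum_congr rfl fun j _ => ?_
  rw [pderiv_comp (g := fun t => t ^ 2) (hasDerivAt_pow 2 _) (hd j)]
  norm_num
  ring

lemma pderiv_gradSq_of_isLocalMax (hw : ContDiffAt ℝ 2 w x) (hφ : DifferentiableAt ℝ φ x)
    (hmax : IsLocalMax (fun y => Real.exp (φ y) * gradSq w y) x) (i : Fin n) :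
    pderiv i (gradSq w) x = -(gradSq w x * pderiv i φ x) := by
  have h := hmax.pderiv_eq_zero i
  rw [pderiv_mul hφ.exp (hw.gradSq.differentiableAt one_ne_zero),
    pderiv_comp (Real.hasDerivAt_exp _) hφ] at h
  have h2 : Real.exp (φ x) * (pderiv i (gradSq w) x + gradSq w x * pderiv i φ x) = 0 := by
    linarith
  have := (mul_eq_zero.1 h2).resolve_left (Real.exp_ne_zero _)
  linarith

lemma elaplacian_exp_mul_sum_sq {g : Fin n → EuclideanSpace ℝ (Fin n) → ℝ}
    (hφ : ContDiffAt ℝ 2 φ x) (hg : ∀ j, ContDiffAt ℝ 2 (g j) x) :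
    elaplacian (fun y => Real.exp (φ y) * ∑ j, g j y ^ 2) x
      = Real.exp (φ x) * ((∑ i, (pderiv i (pderiv i φ) x + pderiv i φ x ^ 2)) * (∑ j, g j x ^ 2)
        + 4 * (∑ i, pderiv i φ x * ∑ j, g j x * pderiv i (g j) x)
        + 2 * (∑ i, ∑ j, pderiv i (g j) x ^ 2) + 2 * ∑ j, g j x * elaplacian (g j) x) := by
  have e4 : ∑ j, g j x * elaplacian (g j) x
      = ∑ i, ∑ j, g j x * pderiv i (pderiv i (g j)) x := by
    simp only [elaplacian_eq_sum_pderiv, Finset.mul_sum]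
    rw [Finset.sum_comm]
  rw [e4, elaplacian_eq_sum_pderiv, Finset.sum_mul, Finset.mul_sum, Finset.mul_sum,
    Finset.mul_sum, ← Finset.sum_add_distrib, ← Finset.sum_add_distrib, ← Finset.sum_add_distrib,
    Finset.mul_sum]
  refine Finset.sum_congr rfl fun i _ => ?_
  have hsq : ∀ j : Fin n, ContDiffAt ℝ 2 (fun y => g j y ^ 2) x := fun j => (hg j).pow 2
  rw [pderiv_pderiv_mul hφ.exp (ContDiffAt.sum fun j _ => hsq j),
    pderiv_pderiv_comp (.of_forall Real.hasDerivAt_exp) (Real.hasDerivAt_exp _) hφ,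
    pderiv_comp (Real.hasDerivAt_exp _) (hφ.differentiableAt two_ne_zero),
    pderiv_sum fun j _ => (hsq j).differentiableAt two_ne_zero,
    pderiv_pderiv_sum fun j _ => hsq j]
  simp only [Finset.mul_sum, ← Finset.sum_add_distrib]
  refine Finset.sum_congr rfl fun j _ => ?_
  have hd2 : ∀ t : ℝ, HasDerivAt (fun t : ℝ => t ^ 2) (2 * t) t := fun t => by
    simpa using hasDerivAt_pow 2 t
  rw [pderiv_pderiv_comp (g := fun t => t ^ 2) (g' := fun t => 2 * t) (g'' := 2)
    (.of_forall hd2) (by simpa using (hasDerivAt_id (g j x)).const_mul 2) (hg j),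
    pderiv_comp (g := fun t => t ^ 2) (hd2 _) ((hg j).differentiableAt two_ne_zero)]
  ring

lemma elaplacian_diffQuot {k : ℕ} {j : Fin n} (h1 : ContDiffAt ℝ 2 w (x + shift k j))
    (h2 : ContDiffAt ℝ 2 w x) :
    elaplacian (diffQuot k j w) x = diffQuot k j (elaplacian w) x := by
  have hcont : ContinuousAt (fun y => y + shift k j) x := by fun_prop
  have h : ∀ i, pderiv i (diffQuot k j w) =ᶠ[𝓝 x] diffQuot k j (pderiv i w) := by
    intro i
    filter_upwards [hcont.eventually (eventually_differentiableAt h1),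
      eventually_differentiableAt h2] with y h3 h4 using pderiv_diffQuot h3 h4 i
  have h' : ∀ i, pderiv i (pderiv i (diffQuot k j w)) x = diffQuot k j (pderiv i (pderiv i w)) x :=
    fun i => by
      rw [(h i).pderiv_eq, pderiv_diffQuot ((h1.pderiv_one i).differentiableAt one_ne_zero)
        ((h2.pderiv_one i).differentiableAt one_ne_zero)]
  simp only [elaplacian_eq_sum_pderiv, h', diffQuot, ← Finset.mul_sum, Finset.sum_sub_distrib]

lemma ContDiffAt.continuousAt_pderiv_pderiv (hw : ContDiffAt ℝ 2 w x) (i : Fin n) :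
    ContinuousAt (_root_.pderiv i (_root_.pderiv i w)) x :=
  ((hw.pderiv_one i).pderiv (k := 0) (by norm_num) i).continuousAt

/-- The weak Bochner formula, tested at a local maximum. -/
lemma bochner_of_max {δ : ℝ} (hδ : 0 < δ) (hw : ∀ y ∈ closedBall x δ, ContDiffAt ℝ 2 w y)
    (hφ : ∀ y ∈ closedBall x δ, ContDiffAt ℝ 2 φ y) (hf : ContDiffAt ℝ 1 (elaplacian w) x)
    (hmax : ∀ y ∈ closedBall x δ,
      Real.exp (φ y) * gradSq w y ≤ Real.exp (φ x) * gradSq w x) :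
    (elaplacian φ x + gradSq φ x) * gradSq w x
      + 4 * (∑ i, pderiv i φ x * ∑ j, pderiv j w x * pderiv j (pderiv i w) x)
      + 2 * (∑ i, ∑ j, pderiv j (pderiv i w) x ^ 2)
      + 2 * ∑ j, pderiv j w x * pderiv j (elaplacian w) x ≤ 0 := by
  have hx : x ∈ closedBall x δ := mem_closedBall_self hδ.le
  have hwx := hw x hx
  have hφx := hφ x hx
  set Q : ℕ → EuclideanSpace ℝ (Fin n) → ℝ :=
    fun k y => Real.exp (φ y) * ∑ j, diffQuot k j w y ^ 2 with hQ
  have hev : ∀ᶠ k : ℕ × EuclideanSpace ℝ (Fin n) in atTop ×ˢ 𝓝 x,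
      ContDiffAt ℝ 2 φ k.2 ∧ ContDiffAt ℝ 2 w k.2 ∧ ∀ j, ContDiffAt ℝ 2 w (k.2 + shift k.1 j) :=
    (tendsto_snd.eventually (hφx.eventually (by simp))).and
      ((tendsto_snd.eventually (hwx.eventually (by simp))).and (eventually_all.2 fun j =>
        (tendsto_add_shift x j).eventually (hwx.eventually (by simp))))
  have key := limit_elaplacian_nonpos (Q := Q) hδ hmax (H := Real.exp (φ x) *
    ((∑ i, (pderiv i (pderiv i φ) x + pderiv i φ x ^ 2)) * (∑ j, pderiv j w x ^ 2)
      + 4 * (∑ i, pderiv i φ x * ∑ j, pderiv j w x * pderiv j (pderiv i w) x)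
      + 2 * (∑ i, ∑ j, pderiv j (pderiv i w) x ^ 2)
      + 2 * ∑ j, pderiv j w x * pderiv j (elaplacian w) x)) ?_ ?_ ?_
  · have := nonpos_of_mul_nonpos_right key (Real.exp_pos _)
    rwa [Finset.sum_add_distrib] at this
  · intro y hy
    exact ((hφ y hy).continuousAt.tendsto.comp tendsto_snd).rexp.mul
      (tendsto_finsetSum _ fun j _ => (tendsto_diffQuot ((hw y hy).of_le (by norm_num)) j).pow 2)
  · filter_upwards [hev] with k hk
    exact hk.1.exp.mul (ContDiffAt.sum fun j _ => ((hk.2.2 j).diffQuot hk.2.1).pow 2)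
  · have hsnd : Tendsto (fun k : ℕ × EuclideanSpace ℝ (Fin n) => k.2) (atTop ×ˢ 𝓝 x) (𝓝 x) :=
      tendsto_snd
    have hcw := fun j : Fin n => tendsto_diffQuot (hwx.of_le (by norm_num)) j
    have hcw' := fun i j : Fin n => tendsto_diffQuot (hwx.pderiv_one i) j
    refine Tendsto.congr' (f₁ := fun k : ℕ × EuclideanSpace ℝ (Fin n) => Real.exp (φ k.2) *
      ((∑ i, (pderiv i (pderiv i φ) k.2 + pderiv i φ k.2 ^ 2)) * (∑ j, diffQuot k.1 j w k.2 ^ 2)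
      + 4 * (∑ i, pderiv i φ k.2 * ∑ j, diffQuot k.1 j w k.2 * diffQuot k.1 j (pderiv i w) k.2)
      + 2 * (∑ i, ∑ j, diffQuot k.1 j (pderiv i w) k.2 ^ 2)
      + 2 * ∑ j, diffQuot k.1 j w k.2 * diffQuot k.1 j (elaplacian w) k.2)) ?_ ?_
    · filter_upwards [hev] with k hk
      rw [hQ, elaplacian_exp_mul_sum_sq hk.1 fun j => (hk.2.2 j).diffQuot hk.2.1]
      simp only [elaplacian_diffQuot (hk.2.2 _) hk.2.1, pderiv_diffQuot
        ((hk.2.2 _).differentiableAt two_ne_zero) (hk.2.1.differentiableAt two_ne_zero)]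
    · refine (hφx.continuousAt.tendsto.comp hsnd).rexp.mul
        ((((Tendsto.mul ?_ ?_).add (Tendsto.const_mul 4 ?_)).add
          (Tendsto.const_mul 2 ?_)).add (Tendsto.const_mul 2 ?_))
      · exact tendsto_finsetSum _ fun i _ =>
          ((hφx.continuousAt_pderiv_pderiv i).tendsto.comp hsnd).add
            (((hφx.pderiv_one i).continuousAt.tendsto.comp hsnd).pow 2)
      · exact tendsto_finsetSum _ fun j _ => (hcw j).pow 2
      · exact tendsto_finsetSum _ fun i _ =>
          ((hφx.pderiv_one i).continuousAt.tendsto.comp hsnd).mul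
            (tendsto_finsetSum _ fun j _ => (hcw j).mul (hcw' i j))
      · exact tendsto_finsetSum _ fun i _ => tendsto_finsetSum _ fun j _ => (hcw' i j).pow 2
      · exact tendsto_finsetSum _ fun j _ => (hcw j).mul (tendsto_diffQuot hf j)

lemma bernstein_inequality (hn : 2 ≤ n) {δ Z : ℝ} (hδ : 0 < δ)
    (hw : ∀ y ∈ closedBall x δ, ContDiffAt ℝ 2 w y)
    (hφ : ∀ y ∈ closedBall x δ, ContDiffAt ℝ 2 φ y) (hf : ContDiffAt ℝ 1 (elaplacian w) x)
    (hmax : ∀ y ∈ closedBall x δ,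
      Real.exp (φ y) * gradSq w y ≤ Real.exp (φ x) * gradSq w x)
    (hY : 0 < gradSq w x) (hZ : Z = ∑ i, pderiv i w x * pderiv i φ x) :
    gradSq w x * elaplacian φ x - Z ^ 2 / 2
      + 2 * ((elaplacian w x + Z / 2) ^ 2 / ((n : ℝ) - 1))
      + 2 * ∑ j, pderiv j w x * pderiv j (elaplacian w) x ≤ 0 := by
  have hx : x ∈ closedBall x δ := mem_closedBall_self hδ.le
  have h1 := bochner_of_max hδ hw hφ hf hmax
  have hloc : IsLocalMax (fun y => Real.exp (φ y) * gradSq w y) x :=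
    mem_of_superset (closedBall_mem_nhds x hδ) hmax
  have hA : ∀ i, -(gradSq w x * pderiv i φ x) / 2
      = ∑ j, pderiv j (pderiv i w) x * pderiv j w x := by
    intro i
    rw [← pderiv_gradSq_of_isLocalMax (hw x hx) ((hφ x hx).differentiableAt two_ne_zero) hloc i,
      pderiv_gradSq (hw x hx), mul_div_cancel_left₀ _ two_ne_zero]
    refine Finset.sum_congr rfl fun j _ => ?_
    rw [pderiv_comm (hw x hx) i j, mul_comm]
  have h2 := sum_sq_symm_ge hn (M := fun i j => pderiv j (pderiv i w) x)
    (fun i j => pderiv_comm (hw x hx) j i) (v := fun i => pderiv i w x)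
    (A := fun i => -(gradSq w x * pderiv i φ x) / 2) (Y := gradSq w x) (t := -Z / 2) rfl hY hA
    (by
      rw [hZ, ← Finset.sum_neg_distrib, Finset.sum_div, Finset.sum_mul]
      exact Finset.sum_congr rfl fun i _ => by ring)
  have h3 : ∑ i, pderiv i φ x * ∑ j, pderiv j w x * pderiv j (pderiv i w) x
      = -(gradSq w x * gradSq φ x) / 2 := by
    rw [gradSq.eq_1 φ, Finset.mul_sum, ← Finset.sum_neg_distrib, Finset.sum_div]
    refine Finset.sum_congr rfl fun i _ => ?_
    have := hA i
    simp only [mul_comm (pderiv _ (pderiv i w) x)] at this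
    rw [← this]
    ring
  have h4 : 2 * (∑ i, (-(gradSq w x * pderiv i φ x) / 2) ^ 2) / gradSq w x
      = gradSq w x * gradSq φ x / 2 := by
    have : ∑ i, (-(gradSq w x * pderiv i φ x) / 2) ^ 2
        = gradSq w x ^ 2 / 4 * gradSq φ x := by
      rw [gradSq.eq_1 φ, Finset.mul_sum]
      exact Finset.sum_congr rfl fun i _ => by ring
    rw [this]
    field_simp
    ring
  rw [h3] at h1
  rw [h4] at h2
  have h5 : ∑ i, pderiv i (pderiv i w) x - -Z / 2 = elaplacian w x + Z / 2 := by
    rw [elaplacian_eq_sum_pderiv]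
    ring
  rw [h5] at h2
  linarith

end Bernstein

section Absorption

lemma exists_bound_of_subcritical {d m q : ℝ} (hd : 0 < d) (hm : 0 < m) (hmd : d * m < 4)
    (hq : 0 < q) :
    ∃ K > 0, ∀ Y E N B : ℝ, 0 < Y → 0 ≤ E → 0 < B → N ^ 2 ≤ Y * B →
      Y * (-(2 * B)) - (2 * N) ^ 2 / 2 + 2 * ((N - (Y + E)) ^ 2 / d)
        + 2 * (Y * (2 * N) - E * (m * Y - q / 2 * (2 * N))) ≤ 0 → Y ≤ K * B := by
  set c := 1 - d * m / 4 with hc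
  have hc0 : 0 < c := by linarith
  set k := 2 + 2 * d + d * q with hk
  have hk0 : 0 < k := by positivity
  refine ⟨k ^ 2 / c ^ 2 + 4 * d / c, by positivity, fun Y E N B hY hE hB hN h => ?_⟩
  set S := Y + E with hS
  have hS0 : 0 < S := by linarith
  have hmain : (N - S) ^ 2
      ≤ d * (Y * B) + d * N ^ 2 - 2 * d * (Y * N) + d * m * (Y * E) - d * q * (E * N) := by
    have : (N - S) ^ 2 = d / 2 * (2 * ((N - S) ^ 2 / d)) := by field_simp
    have h' := mul_le_mul_of_nonneg_left h (half_pos hd).le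
    rw [mul_zero] at h'
    linarith
  have hYE : d * m * (Y * E) ≤ d * m / 4 * S ^ 2 := by
    have : 0 ≤ d * m * (Y - E) ^ 2 := by positivity
    rw [hS]
    linarith
  set M := |N| with hM
  have hM0 : 0 ≤ M := abs_nonneg N
  have hNM : N ≤ M := le_abs_self N
  have hNM' : -N ≤ M := neg_le_abs N
  have hYB : Y * B ≤ S * B := mul_le_mul_of_nonneg_right (by linarith) hB.le
  have h1 : S * N ≤ S * M := mul_le_mul_of_nonneg_left hNM hS0.le
  have h2 : Y * -N ≤ S * M := (mul_le_mul_of_nonneg_left hNM' hY.le).trans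
    (mul_le_mul_of_nonneg_right (by linarith) hM0)
  have h3 : E * -N ≤ S * M := (mul_le_mul_of_nonneg_left hNM' hE).trans
    (mul_le_mul_of_nonneg_right (by linarith) hM0)
  have hlin : c * S ≤ k * M + 2 * d * B := by
    refine le_of_mul_le_mul_left ?_ hS0
    have h4 := mul_le_mul_of_nonneg_left h2 hd.le
    have h5 := mul_le_mul_of_nonneg_left h3 (mul_pos hd hq).le
    have h6 := mul_le_mul_of_nonneg_left (hN.trans hYB) hd.le
    have h7 := mul_le_mul_of_nonneg_left hYB hd.le
    rw [hc, hk]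
    nlinarith [sq_nonneg N]
  have hkM : k * M ≤ c / 2 * S + k ^ 2 / (2 * c) * B := by
    refine le_of_sq_le_sq ?_ (by positivity)
    have h4 : (k * M) ^ 2 ≤ k ^ 2 * (S * B) := by
      rw [mul_pow, hM, sq_abs]
      exact mul_le_mul_of_nonneg_left (hN.trans hYB) (sq_nonneg k)
    have h5 : k ^ 2 * (S * B) = 4 * ((c / 2 * S) * (k ^ 2 / (2 * c) * B)) := by
      field_simp
      norm_num
    linarith [sq_nonneg (c / 2 * S - k ^ 2 / (2 * c) * B)]
  have hcS : S ≤ (k ^ 2 / c ^ 2 + 4 * d / c) * B := by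
    have : (k ^ 2 / c ^ 2 + 4 * d / c) * B = 2 / c * (k ^ 2 / (2 * c) * B + 2 * d * B) := by
      field_simp
      ring
    rw [this, div_mul_eq_mul_div, le_div_iff₀ hc0]
    linarith
  linarith

lemma exists_bound_of_quadratic {d m q σ k K₁ : ℝ} (hd : 0 < d) (hm : 0 < m) (hq : 0 < q)
    (hσ : 0 ≤ σ) (hk : 0 ≤ k) (hK₁ : 0 < K₁) :
    ∃ K > 0, ∀ Y E N Z B : ℝ, 0 < Y → 0 ≤ E → 0 < B → N ^ 2 ≤ Y * B → Y ≤ K₁ * B →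
      Z = 2 * σ * Y + k * N →
      Y * (-(2 * σ * (Y + E)) - k * B) - Z ^ 2 / 2 + 2 * ((Z / 2 - (Y + E)) ^ 2 / d)
        + 2 * (Y * Z - E * (m * Y - q / 2 * Z)) ≤ 0 → E ≤ K * B := by
  set K₃ := 2 * σ * K₁ + k * (K₁ + 1) with hK₃
  have hK₃0 : 0 ≤ K₃ := by positivity
  set a := K₃ + d / 2 * (2 * σ * K₁ + 2 * m * K₁ + q * K₃) with ha
  set b := d / 2 * (2 * σ * K₁ ^ 2 + k * K₁ + K₃ ^ 2 / 2 + 2 * (K₁ * K₃)) with hb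
  have ha0 : 0 ≤ a := by positivity
  have hb0 : 0 ≤ b := by positivity
  refine ⟨a + b + 1, by positivity, fun Y E N Z B hY hE hB hN hYB hZ h => ?_⟩
  have hNB : |N| ≤ (K₁ + 1) * B := by
    refine abs_le_of_sq_le_sq ?_ (by positivity)
    have h1 : Y * B ≤ K₁ * B * B := mul_le_mul_of_nonneg_right hYB hB.le
    have h2 : 0 ≤ (K₁ ^ 2 + K₁ + 1) * B ^ 2 := by positivity
    linarith
  have hZB : |Z| ≤ K₃ * B := by
    rw [hZ, hK₃]
    refine (abs_add_le _ _).trans ?_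
    rw [abs_of_nonneg (by positivity : 0 ≤ 2 * σ * Y), abs_mul, abs_of_nonneg hk]
    have h1 : 2 * σ * Y ≤ 2 * σ * (K₁ * B) := mul_le_mul_of_nonneg_left hYB (by positivity)
    have h2 := mul_le_mul_of_nonneg_left hNB hk
    linarith
  obtain ⟨hZ1, hZ2⟩ := abs_le.1 hZB
  have hmain : (Z / 2 - (Y + E)) ^ 2 ≤ d / 2 * (2 * σ * (Y * Y) + 2 * σ * (Y * E) + k * (Y * B)
      + Z ^ 2 / 2 + 2 * (Y * -Z) + 2 * m * (Y * E) + q * (E * -Z)) := by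
    have : (Z / 2 - (Y + E)) ^ 2 = d / 2 * (2 * ((Z / 2 - (Y + E)) ^ 2 / d)) := by field_simp
    rw [this]
    refine mul_le_mul_of_nonneg_left ?_ (half_pos hd).le
    linarith
  have hYY : Y * Y ≤ K₁ * B * (K₁ * B) := mul_self_le_mul_self hY.le hYB
  have hYE : Y * E ≤ K₁ * B * E := mul_le_mul_of_nonneg_right hYB hE
  have hYB' : Y * B ≤ K₁ * B * B := mul_le_mul_of_nonneg_right hYB hB.le
  have hZZ : Z ^ 2 ≤ (K₃ * B) ^ 2 := sq_le_sq' hZ1 hZ2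
  have hYZ : Y * -Z ≤ K₁ * B * (K₃ * B) :=
    (mul_le_mul_of_nonneg_left (by linarith) hY.le).trans
      (mul_le_mul_of_nonneg_right hYB (by positivity))
  have hEZ : E * -Z ≤ E * (K₃ * B) := mul_le_mul_of_nonneg_left (by linarith) hE
  have hEZ' : E * Z ≤ E * (K₃ * B) := mul_le_mul_of_nonneg_left hZ2 hE
  have hright : 2 * σ * (Y * Y) + 2 * σ * (Y * E) + k * (Y * B)
      + Z ^ 2 / 2 + 2 * (Y * -Z) + 2 * m * (Y * E) + q * (E * -Z)
      ≤ 2 * σ * (K₁ * B * (K₁ * B)) + 2 * σ * (K₁ * B * E) + k * (K₁ * B * B)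
      + (K₃ * B) ^ 2 / 2 + 2 * (K₁ * B * (K₃ * B)) + 2 * m * (K₁ * B * E)
      + q * (E * (K₃ * B)) := by
    gcongr
  have hquad : E ^ 2 ≤ a * (E * B) + b * B ^ 2 := by
    have h1 := hmain.trans (mul_le_mul_of_nonneg_left hright (half_pos hd).le)
    have h2 : E ^ 2 - E * Z ≤ (Z / 2 - (Y + E)) ^ 2 := by
      linarith [sq_nonneg (Z / 2 - Y), mul_nonneg hY.le hE]
    rw [ha, hb]
    linarith
  by_contra! hlt
  have hBE : B ≤ E := by
    have : 0 ≤ (a + b) * B := by positivity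
    linarith
  have hE0 : 0 < E := hB.trans_le hBE
  have h1 : b * B ^ 2 ≤ b * (E * B) := by
    rw [sq]
    gcongr
  have h2 : E * ((a + b + 1) * B) < E * E := mul_lt_mul_of_pos_left hlt hE0
  have h3 : 0 < E * B := mul_pos hE0 hB
  linarith

end Absorption

section LogEquation

variable {n : ℕ} {w : EuclideanSpace ℝ (Fin n) → ℝ} {x₀ x : EuclideanSpace ℝ (Fin n)}
  {r σ k m q : ℝ}

/-- The cutoff function `1 - |y - x₀|² / r²`. -/
noncomputable def cutoff (x₀ : EuclideanSpace ℝ (Fin n)) (r : ℝ) (y : EuclideanSpace ℝ (Fin n)) :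
    ℝ :=
  1 + -(r ^ 2)⁻¹ * ‖y - x₀‖ ^ 2

lemma contDiff_cutoff : ContDiff ℝ 2 (cutoff x₀ r) :=
  contDiff_const.add (contDiff_const.mul (contDiff_norm_sub_sq x₀))

lemma cutoff_pos (hr : 0 < r) (hx : x ∈ ball x₀ r) : 0 < cutoff x₀ r x := by
  have h : ‖x - x₀‖ ^ 2 < r ^ 2 := pow_lt_pow_left₀ (mem_ball_iff_norm.1 hx) (norm_nonneg _)
    two_ne_zero
  have : (r ^ 2)⁻¹ * ‖x - x₀‖ ^ 2 < 1 := by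
    rw [inv_mul_lt_iff₀ (by positivity)]
    simpa using h
  rw [cutoff]
  linarith

lemma cutoff_le_one : cutoff x₀ r x ≤ 1 := by
  have : 0 ≤ (r ^ 2)⁻¹ * ‖x - x₀‖ ^ 2 := by positivity
  rw [cutoff]
  linarith

lemma cutoff_eq_zero (hr : 0 < r) (hx : ‖x - x₀‖ = r) : cutoff x₀ r x = 0 := by
  rw [cutoff, hx]
  field_simp
  ring

lemma pderiv_cutoff (i : Fin n) :
    pderiv i (cutoff x₀ r) x = -(r ^ 2)⁻¹ * pderiv i (fun y => ‖y - x₀‖ ^ 2) x := by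
  have h := (contDiff_norm_sub_sq x₀).contDiffAt (x := x) |>.differentiableAt two_ne_zero
  change pderiv i (fun y => 1 + -(r ^ 2)⁻¹ * ‖y - x₀‖ ^ 2) x = _
  rw [pderiv_comp (g := fun t => 1 + -(r ^ 2)⁻¹ * t) (g' := -(r ^ 2)⁻¹) _ h]
  simpa using ((hasDerivAt_id (‖x - x₀‖ ^ 2)).const_mul (-(r ^ 2)⁻¹)).const_add 1

lemma gradSq_cutoff : gradSq (cutoff x₀ r) x = ((r ^ 2)⁻¹) ^ 2 * (4 * ‖x - x₀‖ ^ 2) := by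
  rw [← gradSq_norm_sub_sq, gradSq, gradSq, Finset.mul_sum]
  exact Finset.sum_congr rfl fun i _ => by rw [pderiv_cutoff]; ring

lemma elaplacian_cutoff : elaplacian (cutoff x₀ r) x = -(r ^ 2)⁻¹ * (2 * n) := by
  have h0 : ∀ y, elaplacian (fun _ : EuclideanSpace ℝ (Fin n) => (1 : ℝ)) y = 0 := by
    intro y
    simp [elaplacian]
  change elaplacian (fun y => 1 + -(r ^ 2)⁻¹ * ‖y - x₀‖ ^ 2) x = _
  rw [elaplacian_add contDiffAt_const
    (contDiffAt_const.mul (contDiff_norm_sub_sq x₀).contDiffAt), h0,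
    elaplacian_const_mul (contDiff_norm_sub_sq x₀).contDiffAt, elaplacian_norm_sub_sq, zero_add]

lemma log_cutoff_bounds (hr : 0 < r) (hx : x ∈ ball x₀ r) :
    gradSq (fun y => Real.log (cutoff x₀ r y)) x
        ≤ (4 + 2 * n) / (r ^ 2 * cutoff x₀ r x ^ 2) ∧
      -((4 + 2 * n) / (r ^ 2 * cutoff x₀ r x ^ 2))
        ≤ elaplacian (fun y => Real.log (cutoff x₀ r y)) x := by
  have hη := cutoff_pos hr hx
  have hη1 : cutoff x₀ r x ≤ 1 := cutoff_le_one
  have hc : ContDiffAt ℝ 2 (cutoff x₀ r) x := contDiff_cutoff.contDiffAt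
  have h1 : gradSq (fun y => Real.log (cutoff x₀ r y)) x
      = gradSq (cutoff x₀ r) x / cutoff x₀ r x ^ 2 :=
    gradSq_log (hc.differentiableAt two_ne_zero) hη.ne'
  have h : ‖x - x₀‖ ^ 2 ≤ r ^ 2 := pow_le_pow_left₀ (norm_nonneg _) (mem_ball_iff_norm.1 hx).le 2
  have h2 : gradSq (cutoff x₀ r) x / cutoff x₀ r x ^ 2 ≤ 4 / (r ^ 2 * cutoff x₀ r x ^ 2) := by
    rw [gradSq_cutoff, ← div_div]
    refine div_le_div_of_nonneg_right ?_ (by positivity)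
    rw [le_div_iff₀ (by positivity)]
    have : ((r ^ 2)⁻¹) ^ 2 * (4 * ‖x - x₀‖ ^ 2) * r ^ 2 = 4 * ((r ^ 2)⁻¹ * ‖x - x₀‖ ^ 2) := by
      field_simp
    rw [this]
    have : (r ^ 2)⁻¹ * ‖x - x₀‖ ^ 2 ≤ 1 := by
      rw [inv_mul_le_iff₀ (by positivity)]
      simpa using h
    linarith
  have h3 : (r ^ 2)⁻¹ * (2 * n) / cutoff x₀ r x ≤ 2 * n / (r ^ 2 * cutoff x₀ r x ^ 2) := by
    rw [div_le_div_iff₀ hη (by positivity)]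
    have : (r ^ 2)⁻¹ * (2 * n) * (r ^ 2 * cutoff x₀ r x ^ 2) = 2 * n * cutoff x₀ r x ^ 2 := by
      field_simp
    rw [this]
    have : cutoff x₀ r x ^ 2 ≤ cutoff x₀ r x := by nlinarith
    gcongr
  have h4 : (0 : ℝ) ≤ 2 * n / (r ^ 2 * cutoff x₀ r x ^ 2) := by positivity
  rw [elaplacian_log hc hη.ne', h1, add_div, elaplacian_cutoff]
  have h5 : -(r ^ 2)⁻¹ * (2 * n) / cutoff x₀ r x
      = -((r ^ 2)⁻¹ * (2 * n) / cutoff x₀ r x) := by ring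
  rw [h5]
  constructor <;> linarith

/-- The localized quantity `e^{2σw} |∇w|²` attains an interior maximum. -/
lemma exists_localized_max (hr : 0 < r) (hk : 0 < k)
    (hw : ∀ y ∈ closedBall x₀ r, ContDiffAt ℝ 2 w y) (h0 : 0 < gradSq w x₀) (σ : ℝ) :
    ∃ x ∈ ball x₀ r, 0 < gradSq w x ∧
      Real.exp (2 * σ * w x₀) * gradSq w x₀
        ≤ Real.exp (2 * σ * w x) * cutoff x₀ r x ^ k * gradSq w x ∧
      ∃ δ > 0, ∀ y ∈ closedBall x δ, y ∈ ball x₀ r ∧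
        Real.exp (2 * σ * w y + k * Real.log (cutoff x₀ r y)) * gradSq w y
          ≤ Real.exp (2 * σ * w x + k * Real.log (cutoff x₀ r x)) * gradSq w x := by
  set F : EuclideanSpace ℝ (Fin n) → ℝ :=
    fun y => Real.exp (2 * σ * w y) * cutoff x₀ r y ^ k * gradSq w y with hF
  have hcont : ContinuousOn F (closedBall x₀ r) := by
    intro y hy
    refine ContinuousAt.continuousWithinAt ?_
    exact (((continuousAt_const.mul (hw y hy).continuousAt).rexp).mul
      (contDiff_cutoff.continuous.continuousAt.rpow_const (Or.inr hk.le))).mul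
      (hw y hy).gradSq.continuousAt
  obtain ⟨x, hx, hmax⟩ := (isCompact_closedBall x₀ r).exists_isMaxOn
    ⟨x₀, mem_closedBall_self hr.le⟩ hcont
  have hFx₀ : F x₀ = Real.exp (2 * σ * w x₀) * gradSq w x₀ := by simp [hF, cutoff]
  have hFle : F x₀ ≤ F x := hmax (mem_closedBall_self hr.le)
  have hFpos : 0 < F x := by
    refine lt_of_lt_of_le ?_ hFle
    rw [hFx₀]
    exact mul_pos (Real.exp_pos _) h0
  have hxb : x ∈ ball x₀ r := by
    rw [mem_ball_iff_norm]
    refine lt_of_le_of_ne (mem_closedBall_iff_norm.1 hx) fun heq => hFpos.ne' ?_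
    simp [hF, cutoff_eq_zero hr heq, Real.zero_rpow hk.ne']
  have hY : 0 < gradSq w x :=
    (gradSq_nonneg w x).lt_of_ne fun h => hFpos.ne' (by simp [hF, ← h])
  have hexp : ∀ y ∈ ball x₀ r,
      Real.exp (2 * σ * w y + k * Real.log (cutoff x₀ r y)) * gradSq w y = F y := by
    intro y hy
    rw [hF, Real.exp_add, mul_comm k, ← Real.rpow_def_of_pos (cutoff_pos hr hy)]
  obtain ⟨δ, hδ, hδb⟩ := Metric.nhds_basis_closedBall.mem_iff.1 (isOpen_ball.mem_nhds hxb)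
  refine ⟨x, hxb, hY, hFx₀ ▸ hFle, δ, hδ, fun y hy => ⟨hδb hy, ?_⟩⟩
  rw [hexp y (hδb hy), hexp x hxb]
  exact hmax (ball_subset_closedBall (hδb hy))

/-- The inequality satisfied at the maximum point of the localized quantity, for `w` the logarithm
of a solution. -/
lemma localized_max_inequality (hn : 2 ≤ n) (hr : 0 < r) (hk : 0 < k)
    (hw : ∀ y ∈ ball x₀ r, ContDiffAt ℝ 2 w y)
    (heq : ∀ y ∈ ball x₀ r,
      elaplacian w y = -(gradSq w y + Real.exp (m * w y) * gradSq w y ^ (q / 2)))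
    (hx : x ∈ ball x₀ r) (hY : 0 < gradSq w x) {δ : ℝ} (hδ : 0 < δ)
    (hmax : ∀ y ∈ closedBall x δ, y ∈ ball x₀ r ∧
      Real.exp (2 * σ * w y + k * Real.log (cutoff x₀ r y)) * gradSq w y
        ≤ Real.exp (2 * σ * w x + k * Real.log (cutoff x₀ r x)) * gradSq w x)
    {Y E B : ℝ} (hYdef : Y = gradSq w x) (hE : E = Real.exp (m * w x) * gradSq w x ^ (q / 2))
    (hB : B = (4 + 2 * n) / (r ^ 2 * cutoff x₀ r x ^ 2)) :
    ∃ N Z : ℝ, N ^ 2 ≤ Y * B ∧ Z = 2 * σ * Y + k * N ∧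
      Y * (-(2 * σ * (Y + E)) - k * B) - Z ^ 2 / 2
        + 2 * ((Z / 2 - (Y + E)) ^ 2 / ((n : ℝ) - 1))
        + 2 * (Y * Z - E * (m * Y - q / 2 * Z)) ≤ 0 := by
  set ℓ : EuclideanSpace ℝ (Fin n) → ℝ := fun y => Real.log (cutoff x₀ r y) with hℓ
  set φ : EuclideanSpace ℝ (Fin n) → ℝ := fun y => 2 * σ * w y + k * ℓ y with hφ
  have hℓc : ∀ y ∈ ball x₀ r, ContDiffAt ℝ 2 ℓ y :=
    fun y hy => contDiff_cutoff.contDiffAt.log (cutoff_pos hr hy).ne'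
  have hφc : ∀ y ∈ ball x₀ r, ContDiffAt ℝ 2 φ y :=
    fun y hy => (contDiffAt_const.mul (hw y hy)).add (contDiffAt_const.mul (hℓc y hy))
  have hwd := (hw x hx).differentiableAt two_ne_zero
  have hℓd := (hℓc x hx).differentiableAt two_ne_zero
  have hφi : ∀ i, pderiv i φ x = 2 * σ * pderiv i w x + k * pderiv i ℓ x := fun i => by
    rw [hφ, pderiv_add (hwd.const_mul _) (hℓd.const_mul _), pderiv_const_mul hwd,
      pderiv_const_mul hℓd]
  have hφL : elaplacian φ x = 2 * σ * elaplacian w x + k * elaplacian ℓ x := by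
    rw [hφ, elaplacian_add (contDiffAt_const.mul (hw x hx)) (contDiffAt_const.mul (hℓc x hx)),
      elaplacian_const_mul (hw x hx), elaplacian_const_mul (hℓc x hx)]
  have hYc : ContDiffAt ℝ 1 (gradSq w) x := (hw x hx).gradSq
  have hYd := hYc.differentiableAt one_ne_zero
  have hEc : ContDiffAt ℝ 1 (fun y => Real.exp (m * w y) * gradSq w y ^ (q / 2)) x :=
    (contDiffAt_const.mul ((hw x hx).of_le (by norm_num))).exp.mul
      (hYc.rpow_const_of_ne hY.ne')
  have hfe : elaplacian w =ᶠ[𝓝 x]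
      fun y => -1 * (gradSq w y + Real.exp (m * w y) * gradSq w y ^ (q / 2)) := by
    filter_upwards [isOpen_ball.mem_nhds hx] with y hy
    rw [heq y hy, neg_one_mul]
  have hfc : ContDiffAt ℝ 1 (elaplacian w) x :=
    (contDiffAt_const.mul (hYc.add hEc)).congr_of_eventuallyEq hfe
  have hloc : IsLocalMax (fun y => Real.exp (φ y) * gradSq w y) x :=
    mem_of_superset (closedBall_mem_nhds x hδ) fun y hy => (hmax y hy).2
  have hf : ∀ j, pderiv j (elaplacian w) x
      = Y * pderiv j φ x - E * (m * pderiv j w x - q / 2 * pderiv j φ x) := by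
    intro j
    have h1 : pderiv j (fun y => gradSq w y ^ (q / 2)) x
        = gradSq w x ^ (q / 2) * (-(q / 2) * pderiv j φ x) := by
      rw [pderiv_comp (g := fun t => t ^ (q / 2)) (Real.hasDerivAt_rpow_const (Or.inl hY.ne')) hYd,
        pderiv_gradSq_of_isLocalMax (hw x hx) ((hφc x hx).differentiableAt two_ne_zero) hloc,
        Real.rpow_sub_one hY.ne']
      field_simp
    have h2 : pderiv j (fun y => Real.exp (m * w y)) x
        = Real.exp (m * w x) * (m * pderiv j w x) := by
      rw [pderiv_comp (Real.hasDerivAt_exp _) (hwd.const_mul m), pderiv_const_mul hwd]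
    rw [hfe.pderiv_eq, pderiv_const_mul ((hYc.add hEc).differentiableAt one_ne_zero),
      pderiv_add hYd (hEc.differentiableAt one_ne_zero),
      pderiv_mul (hwd.const_mul m).exp (hYd.rpow_const (Or.inl hY.ne')), h1, h2,
      pderiv_gradSq_of_isLocalMax (hw x hx) ((hφc x hx).differentiableAt two_ne_zero) hloc, hE,
      hYdef]
    ring
  set N := ∑ i, pderiv i w x * pderiv i ℓ x with hN
  set Z := ∑ i, pderiv i w x * pderiv i φ x with hZ
  have hYsum : ∑ i, pderiv i w x * pderiv i w x = Y := by
    rw [hYdef, gradSq]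
    exact Finset.sum_congr rfl fun i _ => (sq _).symm
  have hZN : Z = 2 * σ * Y + k * N := by
    rw [hZ, hN, ← hYsum, Finset.mul_sum, Finset.mul_sum, ← Finset.sum_add_distrib]
    exact Finset.sum_congr rfl fun i _ => by rw [hφi]; ring
  have hfZ : ∑ j, pderiv j w x * pderiv j (elaplacian w) x
      = Y * Z - E * (m * Y - q / 2 * Z) := by
    have : ∑ j, pderiv j w x * pderiv j (elaplacian w) x
        = Y * ∑ j, pderiv j w x * pderiv j φ x
          - E * (m * ∑ j, pderiv j w x * pderiv j w x
            - q / 2 * ∑ j, pderiv j w x * pderiv j φ x) := by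
      simp only [Finset.mul_sum, ← Finset.sum_sub_distrib]
      exact Finset.sum_congr rfl fun j _ => by rw [hf]; ring
    rw [this, hYsum]
  have hbern := bernstein_inequality hn (Z := Z) hδ (fun y hy => hw y (hmax y hy).1)
    (fun y hy => hφc y (hmax y hy).1) hfc (fun y hy => (hmax y hy).2) hY rfl
  obtain ⟨hb1, hb2⟩ := log_cutoff_bounds hr hx
  rw [← hB] at hb1 hb2
  refine ⟨N, Z, ?_, hZN, ?_⟩
  · refine (Finset.sum_mul_sq_le_sq_mul_sq _ _ _).trans ?_
    rw [hYdef]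
    exact mul_le_mul_of_nonneg_left hb1 (gradSq_nonneg w x)
  · rw [hfZ, hφL, heq x hx, ← hE, ← hYdef] at hbern
    have h1 : -(Y + E) + Z / 2 = Z / 2 - (Y + E) := by ring
    rw [h1] at hbern
    have h2 : Y * (k * -B) ≤ Y * (k * elaplacian ℓ x) :=
      mul_le_mul_of_nonneg_left (mul_le_mul_of_nonneg_left hb2 hk.le) (hYdef ▸ hY.le)
    linarith

end LogEquation

section Estimates

variable {n : ℕ} {m p q : ℝ}

/-- The gradient bound for logarithms of solutions at the center of a ball. -/
lemma exists_gradSq_le (hn : 2 ≤ n) (hm : 0 < m) (hnm : ((n : ℝ) - 1) * m < 4) (hq : 0 < q) :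
    ∃ C > 0, ∀ (w : EuclideanSpace ℝ (Fin n) → ℝ) (x₀ : EuclideanSpace ℝ (Fin n)) (R : ℝ),
      0 < R → (∀ y ∈ ball x₀ R, ContDiffAt ℝ 2 w y) →
      (∀ y ∈ ball x₀ R,
        elaplacian w y = -(gradSq w y + Real.exp (m * w y) * gradSq w y ^ (q / 2))) →
      gradSq w x₀ ≤ C / R ^ 2 := by
  have hn' : (2 : ℝ) ≤ n := by exact_mod_cast hn
  obtain ⟨K, hK, hbound⟩ := exists_bound_of_subcritical (by linarith) hm hnm hq
  refine ⟨4 * (K * (4 + 2 * n)), by positivity, fun w x₀ R hR hw heq => ?_⟩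
  rcases (gradSq_nonneg w x₀).eq_or_lt with h0 | h0
  · rw [← h0]
    positivity
  have hr : 0 < R / 2 := half_pos hR
  have hsub : ball x₀ (R / 2) ⊆ ball x₀ R := ball_subset_ball (by linarith)
  obtain ⟨x, hx, hY, hle, δ, hδ, hmax⟩ := exists_localized_max hr two_pos
    (fun y hy => hw y (closedBall_subset_ball (by linarith) hy)) h0 0
  obtain ⟨N, Z, hN, hZ, hineq⟩ := localized_max_inequality hn hr two_pos
    (fun y hy => hw y (hsub hy)) (fun y hy => heq y (hsub hy)) hx hY hδ hmax rfl rfl rfl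
  have hh := cutoff_pos hr hx
  have hZ' : Z = 2 * N := by rw [hZ]; ring
  rw [hZ', mul_div_cancel_left₀ N two_ne_zero] at hineq
  have hYK := hbound (gradSq w x) (Real.exp (m * w x) * gradSq w x ^ (q / 2)) N _ hY
    (by positivity) (by positivity) hN (hineq.trans' (le_of_eq (by ring)))
  simp only [mul_zero, zero_mul, Real.exp_zero, one_mul, Real.rpow_ofNat] at hle
  refine hle.trans ((mul_le_mul_of_nonneg_left hYK (by positivity)).trans_eq ?_)
  field_simp
  ring

/-- The weighted gradient bound for logarithms of solutions at the center of a ball. -/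
lemma exists_exp_mul_gradSq_le (hn : 2 ≤ n) (hm : 0 < m) (hnm : ((n : ℝ) - 1) * m < 4)
    (hq : 0 < q) :
    ∃ C > 0, ∀ (w : EuclideanSpace ℝ (Fin n) → ℝ) (x₀ : EuclideanSpace ℝ (Fin n)) (R : ℝ),
      0 < R → (∀ y ∈ ball x₀ R, ContDiffAt ℝ 2 w y) →
      (∀ y ∈ ball x₀ R,
        elaplacian w y = -(gradSq w y + Real.exp (m * w y) * gradSq w y ^ (q / 2))) →
      Real.exp (2 * (m / q) * w x₀) * gradSq w x₀ ≤ (C / R ^ 2) ^ (2 / q) := by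
  have hn' : (2 : ℝ) ≤ n := by exact_mod_cast hn
  obtain ⟨C₁, hC₁, hgrad⟩ := exists_gradSq_le hn hm hnm hq
  obtain ⟨K, hK, hbound⟩ := exists_bound_of_quadratic (d := (n : ℝ) - 1) (σ := m / q) (k := 4 / q)
    (by linarith) hm hq (by positivity) (by positivity) hC₁
  refine ⟨4 * (K * (4 + 2 * n)), by positivity, fun w x₀ R hR hw heq => ?_⟩
  rcases (gradSq_nonneg w x₀).eq_or_lt with h0 | h0
  · rw [← h0, mul_zero]
    positivity
  have hr : 0 < R / 2 := half_pos hR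
  have hk : 0 < 4 / q := by positivity
  have hsub : ball x₀ (R / 2) ⊆ ball x₀ R := ball_subset_ball (by linarith)
  obtain ⟨x, hx, hY, hle, δ, hδ, hmax⟩ := exists_localized_max hr hk
    (fun y hy => hw y (closedBall_subset_ball (by linarith) hy)) h0 (m / q)
  obtain ⟨N, Z, hN, hZ, hineq⟩ := localized_max_inequality hn hr hk
    (fun y hy => hw y (hsub hy)) (fun y hy => heq y (hsub hy)) hx hY hδ hmax rfl rfl rfl
  have hh := cutoff_pos hr hx
  have hsub' : ball x (R / 2) ⊆ ball x₀ R :=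
    ball_subset_ball' (by linarith [mem_ball.1 hx])
  have hYC : gradSq w x ≤ C₁ * ((4 + 2 * n) / ((R / 2) ^ 2 * cutoff x₀ (R / 2) x ^ 2)) := by
    refine (hgrad w x (R / 2) hr (fun y hy => hw y (hsub' hy))
      fun y hy => heq y (hsub' hy)).trans ?_
    rw [div_eq_mul_inv, ← one_div]
    refine mul_le_mul_of_nonneg_left ?_ hC₁.le
    have h1 : cutoff x₀ (R / 2) x ^ 2 ≤ 1 := pow_le_one₀ hh.le cutoff_le_one
    refine div_le_div₀ (by positivity) (by linarith) (by positivity) ?_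
    exact mul_le_of_le_one_right (by positivity) h1
  have hEK := hbound (gradSq w x) _ N Z _ hY (by positivity) (by positivity) hN hYC hZ hineq
  refine hle.trans ?_
  set E := Real.exp (m * w x) * gradSq w x ^ (q / 2) with hE
  have hE0 : 0 ≤ E := by positivity
  have hpow : Real.exp (2 * (m / q) * w x) * cutoff x₀ (R / 2) x ^ (4 / q) * gradSq w x
      = (E * cutoff x₀ (R / 2) x ^ 2) ^ (2 / q) := by
    rw [Real.mul_rpow hE0 (by positivity), hE, Real.mul_rpow (Real.exp_pos _).le (by positivity),
      ← Real.exp_mul, ← Real.rpow_mul hY.le, ← Real.rpow_natCast, ← Real.rpow_mul hh.le]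
    have h1 : q / 2 * (2 / q) = 1 := by field_simp
    have h2 : ((2 : ℕ) : ℝ) * (2 / q) = 4 / q := by push_cast; ring
    have h3 : m * w x * (2 / q) = 2 * (m / q) * w x := by ring
    rw [h1, h2, h3, Real.rpow_one]
    ring
  rw [hpow]
  refine Real.rpow_le_rpow (by positivity) ?_ (by positivity)
  refine (mul_le_mul_of_nonneg_right hEK (by positivity)).trans_eq ?_
  field_simp
  ring

lemma gradSq_log_eq_sq {u : EuclideanSpace ℝ (Fin n) → ℝ} {x : EuclideanSpace ℝ (Fin n)}
    (hu : DifferentiableAt ℝ u x) (hx : u x ≠ 0) :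
    gradSq (fun y => Real.log (u y)) x = (‖gradient u x‖ / u x) ^ 2 := by
  rw [gradSq_log hu hx, ← norm_gradient_sq, div_pow]

lemma norm_gradient_rpow {u : EuclideanSpace ℝ (Fin n) → ℝ} {x : EuclideanSpace ℝ (Fin n)} {a : ℝ}
    (ha : 0 ≤ a) (hu : DifferentiableAt ℝ u x) (hx : 0 < u x) :
    ‖gradient (fun y => u y ^ a) x‖ = a * (u x ^ (a - 1) * ‖gradient u x‖) := by
  refine (pow_left_inj₀ (norm_nonneg _) (by positivity) two_ne_zero).1 ?_
  rw [norm_gradient_sq, ← mul_assoc, mul_pow, norm_gradient_sq, gradSq, gradSq, Finset.mul_sum]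
  refine Finset.sum_congr rfl fun i _ => ?_
  rw [pderiv_comp (g := fun t => t ^ a) (Real.hasDerivAt_rpow_const (Or.inl hx.ne')) hu, mul_pow]

/-- The equation satisfied by the logarithm of a solution. -/
lemma elaplacian_log_of_equation {u : EuclideanSpace ℝ (Fin n) → ℝ}
    {x : EuclideanSpace ℝ (Fin n)} (hu : ContDiffAt ℝ 2 u x) (hx : 0 < u x)
    (heq : elaplacian u x + ‖gradient u x‖ ^ q * u x ^ p = 0) :
    elaplacian (fun y => Real.log (u y)) x
      = -(gradSq (fun y => Real.log (u y)) x + Real.exp ((p + q - 1) * Real.log (u x))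
        * gradSq (fun y => Real.log (u y)) x ^ (q / 2)) := by
  have hd := hu.differentiableAt two_ne_zero
  have h1 : gradSq (fun y => Real.log (u y)) x ^ (q / 2) = ‖gradient u x‖ ^ q / u x ^ q := by
    rw [gradSq_log_eq_sq hd hx.ne', ← Real.rpow_natCast, ← Real.rpow_mul (by positivity),
      ← Real.div_rpow (norm_nonneg _) hx.le]
    congr 1
    push_cast
    ring
  have h2 : Real.exp ((p + q - 1) * Real.log (u x)) = u x ^ p * u x ^ q / u x := by
    rw [mul_comm, ← Real.rpow_def_of_pos hx, Real.rpow_sub_one hx.ne', Real.rpow_add hx]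
  have h3 : 0 < u x ^ q := Real.rpow_pos_of_pos hx q
  rw [h1, h2, elaplacian_log hu hx.ne', gradSq_log hd hx.ne', eq_neg_of_add_eq_zero_left heq]
  field_simp
  ring

/-- The two estimates at the center of a ball: for the logarithmic gradient and for the gradient
of a power. -/
lemma exists_center_estimates (hn : 2 ≤ n) (hq : 0 < q) (hpq1 : 1 < p + q)
    (hpq2 : p + q < ((n : ℝ) + 3) / ((n : ℝ) - 1)) :
    ∃ C₁ > 0, ∃ C₂ > 0, ∀ (x₀ : EuclideanSpace ℝ (Fin n)) (R : ℝ), 0 < R →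
      ∀ u : EuclideanSpace ℝ (Fin n) → ℝ, ContDiffOn ℝ 2 u (ball x₀ R) →
        (∀ x ∈ ball x₀ R, 0 < u x) →
        (∀ x ∈ ball x₀ R, elaplacian u x + ‖gradient u x‖ ^ q * u x ^ p = 0) →
        ‖gradient u x₀‖ / u x₀ ≤ C₁ * R⁻¹ ∧
          u x₀ ^ ((p + q - 1) / q - 1) * ‖gradient u x₀‖ ≤ C₂ * R ^ (-2 / q) := by
  have hn' : (2 : ℝ) ≤ n := by exact_mod_cast hn
  have hm : 0 < p + q - 1 := by linarith
  have hnm : ((n : ℝ) - 1) * (p + q - 1) < 4 := by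
    rw [lt_div_iff₀ (by linarith)] at hpq2
    linarith
  obtain ⟨C₁, hC₁, h1⟩ := exists_gradSq_le hn hm hnm hq
  obtain ⟨C₂, hC₂, h2⟩ := exists_exp_mul_gradSq_le hn hm hnm hq
  refine ⟨√C₁, Real.sqrt_pos.2 hC₁, C₂ ^ (1 / q), by positivity,
    fun x₀ R hR u hu hpos heq => ?_⟩
  have huc : ∀ y ∈ ball x₀ R, ContDiffAt ℝ 2 u y :=
    fun y hy => hu.contDiffAt (isOpen_ball.mem_nhds hy)
  have hwc : ∀ y ∈ ball x₀ R, ContDiffAt ℝ 2 (fun y => Real.log (u y)) y :=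
    fun y hy => (huc y hy).log (hpos y hy).ne'
  have hweq := fun y hy => elaplacian_log_of_equation (huc y hy) (hpos y hy) (heq y hy)
  have hx₀ : x₀ ∈ ball x₀ R := mem_ball_self hR
  have hu0 := hpos x₀ hx₀
  have hgrad := gradSq_log_eq_sq ((huc x₀ hx₀).differentiableAt two_ne_zero) hu0.ne'
  constructor
  · refine le_of_sq_le_sq ?_ (by positivity)
    rw [← hgrad, mul_pow, Real.sq_sqrt hC₁.le, inv_pow, ← div_eq_mul_inv]
    exact h1 _ x₀ R hR hwc hweq
  · refine le_of_sq_le_sq ?_ (by positivity)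
    have hl : (u x₀ ^ ((p + q - 1) / q - 1) * ‖gradient u x₀‖) ^ 2
        = Real.exp (2 * ((p + q - 1) / q) * Real.log (u x₀))
          * gradSq (fun y => Real.log (u y)) x₀ := by
      have : 2 * ((p + q - 1) / q) * Real.log (u x₀)
          = Real.log (u x₀) * ((p + q - 1) / q) + Real.log (u x₀) * ((p + q - 1) / q) := by ring
      rw [hgrad, this, Real.exp_add, ← Real.rpow_def_of_pos hu0, Real.rpow_sub_one hu0.ne']
      ring
    have hr : (C₂ ^ (1 / q) * R ^ (-2 / q)) ^ 2 = (C₂ / R ^ 2) ^ (2 / q) := by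
      rw [mul_pow, ← Real.rpow_mul_natCast hC₂.le, ← Real.rpow_mul_natCast hR.le,
        div_eq_mul_inv C₂, Real.mul_rpow hC₂.le (by positivity), ← Real.rpow_natCast R 2,
        ← Real.rpow_neg hR.le, ← Real.rpow_mul hR.le]
      push_cast
      congr 2 <;> ring
    rw [hl, hr]
    exact h2 _ x₀ R hR hwc hweq

/-- Interpolation between the bound for the logarithmic gradient and the one for a power. -/
lemma norm_le_of_interpolation {a s t v A B : ℝ} (ha : 1 < a) (ht : 0 < t) (hv : 0 ≤ v)
    (hA : v / t ≤ A) (hB : t ^ (a - 1) * v ≤ B) (hs : s = 1 / a) :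
    v ≤ B ^ s * A ^ (1 - s) := by
  have ha0 : 0 < a := by linarith
  have hs0 : 0 < s := by rw [hs]; positivity
  have hs1 : s < 1 := by rw [hs, div_lt_one ha0]; exact ha
  have hA0 : 0 ≤ A := hA.trans' (by positivity)
  have hB0 : 0 ≤ B := hB.trans' (by positivity)
  rcases hv.eq_or_lt with h0 | h0
  · rw [← h0]
    positivity
  have key : v = (t ^ (a - 1) * v) ^ s * (v / t) ^ (1 - s) := by
    rw [Real.mul_rpow (by positivity) hv, Real.div_rpow hv ht.le, ← Real.rpow_mul ht.le]
    have h1 : (a - 1) * s = 1 - s := by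
      rw [hs]
      field_simp
    have h2 : v ^ s * v ^ (1 - s) = v := by
      rw [← Real.rpow_add h0]
      simp
    have h3 : t ^ (1 - s) ≠ 0 := (Real.rpow_pos_of_pos ht _).ne'
    rw [h1]
    field_simp
    exact h2.symm
  calc v = (t ^ (a - 1) * v) ^ s * (v / t) ^ (1 - s) := key
    _ ≤ B ^ s * A ^ (1 - s) := by
      gcongr

end Estimates

/-- **Theorem 2.3 (Euclidean case).** For `n ≥ 2`, `q > 0` and `1 < p + q < (n+3)/(n−1)`,
setting `a = (p+q−1)/q > 0`, there is `C = C(n,p,q) > 0` such that every positive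
classical solution of `Δu + |∇u|^q u^p = 0` on `B(x₀, 2R)` satisfies
`sup_(B(x₀,R)) |∇(u^a)| ≤ C · R^(−2/q)`; if moreover `p > 1`, then
`sup_(B(x₀,R)) |∇u| ≤ C · R^(−1−(2−q)/(p+q−1))`. -/
theorem gradient_power_estimate (n : ℕ) (hn : 2 ≤ n) (p q : ℝ) (hq : 0 < q)
    (hpq1 : 1 < p + q) (hpq2 : p + q < ((n : ℝ) + 3) / ((n : ℝ) - 1)) :
    (∃ C > (0 : ℝ), ∀ (x₀ : EuclideanSpace ℝ (Fin n)) (R : ℝ), 0 < R →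
      ∀ u : EuclideanSpace ℝ (Fin n) → ℝ,
        ContDiffOn ℝ 2 u (Metric.ball x₀ (2 * R)) →
        (∀ x ∈ Metric.ball x₀ (2 * R), 0 < u x) →
        (∀ x ∈ Metric.ball x₀ (2 * R),
          elaplacian u x + ‖gradient u x‖ ^ q * u x ^ p = 0) →
        ∀ x ∈ Metric.ball x₀ R,
          ‖gradient (fun y => u y ^ ((p + q - 1) / q)) x‖ ≤ C * R ^ (-2 / q)) ∧
    (1 < p → ∃ C > (0 : ℝ), ∀ (x₀ : EuclideanSpace ℝ (Fin n)) (R : ℝ), 0 < R →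
      ∀ u : EuclideanSpace ℝ (Fin n) → ℝ,
        ContDiffOn ℝ 2 u (Metric.ball x₀ (2 * R)) →
        (∀ x ∈ Metric.ball x₀ (2 * R), 0 < u x) →
        (∀ x ∈ Metric.ball x₀ (2 * R),
          elaplacian u x + ‖gradient u x‖ ^ q * u x ^ p = 0) →
        ∀ x ∈ Metric.ball x₀ R,
          ‖gradient u x‖ ≤ C * R ^ (-1 - (2 - q) / (p + q - 1))) := by
  obtain ⟨C₁, hC₁, C₂, hC₂, hest⟩ := exists_center_estimates hn hq hpq1 hpq2
  have hsub : ∀ (x₀ : EuclideanSpace ℝ (Fin n)) (R : ℝ), ∀ x ∈ ball x₀ R,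
      ball x R ⊆ ball x₀ (2 * R) := fun x₀ R x hx =>
    ball_subset_ball' (by linarith [mem_ball.1 hx])
  have ha : 0 < (p + q - 1) / q := div_pos (by linarith) hq
  refine ⟨⟨(p + q - 1) / q * C₂, by positivity, fun x₀ R hR u hu hpos heq x hx => ?_⟩,
    fun hp => ⟨C₂ ^ (q / (p + q - 1)) * C₁ ^ (1 - q / (p + q - 1)), by positivity,
      fun x₀ R hR u hu hpos heq x hx => ?_⟩⟩
  all_goals
    have hs := hsub x₀ R x hx
    have hxx := hs (mem_ball_self hR)
    have hud := (hu.contDiffAt (isOpen_ball.mem_nhds hxx)).differentiableAt two_ne_zero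
    obtain ⟨h1, h2⟩ := hest x R hR u (hu.mono hs) (fun y hy => hpos y (hs hy))
      fun y hy => heq y (hs hy)
  · rw [norm_gradient_rpow ha.le hud (hpos x hxx), mul_assoc]
    exact mul_le_mul_of_nonneg_left h2 ha.le
  · have hm : 0 < p + q - 1 := by linarith
    have ha1 : 1 < (p + q - 1) / q := by
      rw [one_lt_div hq]
      linarith
    refine (norm_le_of_interpolation ha1 (hpos x hxx) (norm_nonneg _) h1 h2 rfl).trans_eq ?_
    rw [one_div_div, Real.mul_rpow hC₂.le (by positivity), Real.mul_rpow hC₁.le (by positivity),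
      ← Real.rpow_mul hR.le, Real.inv_rpow hR.le, ← Real.rpow_neg hR.le]
    have hexp : -1 - (2 - q) / (p + q - 1)
        = -2 / q * (q / (p + q - 1)) + -(1 - q / (p + q - 1)) := by
      field_simp
      ring
    rw [hexp, Real.rpow_add hR]
    ring
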